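/- Propagation of regularity for the semiclassical equation (Proposition 3.1): let m ≥ 1 and let V : ℝ → ℝ be of class C^{m+1} with ‖V⁽ⁿ⁾‖_∞ < ∞ for n = 2,…,m+1. If 𝒮 is a strong solution of the semiclassical equation, then for all t ≥ 0, 𝒩_m(t) ≤ 𝒩_m(0) e^{C_m[V] t}, where C_m[V] = m² + 2m + m‖V''‖_∞ + m|V'(0)| + 2^m (1+m) m max_{2 ≤ n ≤ m+1} ‖V⁽ⁿ⁾‖_∞. -/

import Mathlib

open MeasureTheory

noncomputable section

/-- Mixed partial derivative `∂_x^b ∂_y^β` of a function `f(x,y)`. -/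
def pd2 (b β : ℕ) (f : ℝ → ℝ → ℂ) (x y : ℝ) : ℂ :=
  iteratedDeriv b (fun x' => iteratedDeriv β (fun y' => f x' y') y) x

/-- Weighted derivative `x^a ∂_x^b y^α ∂_y^β` of `f(x,y)`. -/
def wD (a b α β : ℕ) (f : ℝ → ℝ → ℂ) (x y : ℝ) : ℂ :=
  (x : ℂ) ^ a * (y : ℂ) ^ α * pd2 b β f x y

/-- Uncurried version of a two-variable function. -/
def unc (f : ℝ → ℝ → ℂ) : ℝ × ℝ → ℂ := fun p => f p.1 p.2

/-- L² norm over ℝ². -/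
def L2 (f : ℝ → ℝ → ℂ) : ℝ := (eLpNorm (unc f) 2 (volume : Measure (ℝ × ℝ))).toReal

/-- L² norm over ℝ. -/
def L2one (f : ℝ → ℂ) : ℝ := (eLpNorm f 2 (volume : Measure ℝ)).toReal

/-- Schwartz-class predicate for smooth functions of two real variables. -/
def IsSchwartz2 (f : ℝ → ℝ → ℂ) : Prop :=
  ContDiff ℝ (⊤ : ℕ∞) (unc f) ∧
    ∀ k n : ℕ, ∃ C : ℝ, ∀ p : ℝ × ℝ, ‖p‖ ^ k * ‖iteratedFDeriv ℝ n (unc f) p‖ ≤ C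

/-- Schwartz-class predicate for smooth functions of one real variable. -/
def IsSchwartz1 (f : ℝ → ℂ) : Prop :=
  ContDiff ℝ (⊤ : ℕ∞) f ∧ ∀ k n : ℕ, ∃ C : ℝ, ∀ x : ℝ, |x| ^ k * ‖iteratedDeriv n f x‖ ≤ C

/-- Time derivative of a time-dependent two-variable function. -/
def dtR (R : ℝ → ℝ → ℝ → ℂ) (t x y : ℝ) : ℂ := deriv (fun s => R s x y) t

/-- For all `a b α β`, the map `t ↦ x^a ∂_x^b y^α ∂_y^β R(t,·,·)` is continuously
differentiable from `[0,∞)` into `L²(ℝ²)` with derivative `x^a ∂_x^b y^α ∂_y^β ∂_t R(t,·,·)`. -/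
def C1intoL2 (R : ℝ → ℝ → ℝ → ℂ) : Prop :=
  ∀ a b α β : ℕ, ∃ Ψ Ψ' : ℝ → Lp ℂ 2 (volume : Measure (ℝ × ℝ)),
    (∀ t : ℝ, 0 ≤ t → (Ψ t : ℝ × ℝ → ℂ) =ᵐ[volume] unc (wD a b α β (R t))) ∧
    (∀ t : ℝ, 0 ≤ t → (Ψ' t : ℝ × ℝ → ℂ) =ᵐ[volume] unc (wD a b α β (dtR R t))) ∧
    (∀ t : ℝ, 0 ≤ t → HasDerivWithinAt Ψ (Ψ' t) (Set.Ici 0) t) ∧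
    ContinuousOn Ψ' (Set.Ici 0)

/-- Regularity part of the notion of strong solution on `[0,∞) × ℝ²`. -/
def IsRegularSol (R : ℝ → ℝ → ℝ → ℂ) : Prop :=
  ContDiffOn ℝ (⊤ : ℕ∞) (fun p : ℝ × ℝ × ℝ => R p.1 p.2.1 p.2.2) {p : ℝ × ℝ × ℝ | 0 ≤ p.1} ∧
  (∀ t : ℝ, 0 ≤ t → IsSchwartz2 (R t)) ∧ C1intoL2 R

/-- Strong solution of the von Neumann equation in Weyl variables. -/
def IsVNSol (hbar : ℝ) (V : ℝ → ℝ) (R : ℝ → ℝ → ℝ → ℂ) : Prop :=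
  IsRegularSol R ∧
  ∀ t : ℝ, 0 ≤ t → ∀ x y : ℝ,
    dtR R t x y = Complex.I * pd2 1 1 (R t) x y -
      Complex.I * (((V (x + hbar * y / 2) - V (x - hbar * y / 2)) / hbar : ℝ) : ℂ) * R t x y

/-- Strong solution of the semiclassical equation. -/
def IsSCSol (V : ℝ → ℝ) (R : ℝ → ℝ → ℝ → ℂ) : Prop :=
  IsRegularSol R ∧
  ∀ t : ℝ, 0 ≤ t → ∀ x y : ℝ,
    dtR R t x y = Complex.I * pd2 1 1 (R t) x y -
      Complex.I * ((deriv V x * y : ℝ) : ℂ) * R t x y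

/-- The weighted Sobolev functional `𝒩_m` applied to a function of `(x,y)`. -/
def NN (m : ℕ) (f : ℝ → ℝ → ℂ) : ℝ :=
  ∑ q ∈ Finset.filter
      (fun q : ℕ × ℕ × ℕ × ℕ => q.1 + q.2.1 + q.2.2.1 + q.2.2.2 ≤ m)
      (Finset.range (m+1) ×ˢ Finset.range (m+1) ×ˢ Finset.range (m+1) ×ˢ Finset.range (m+1)),
    L2 (wD q.1 q.2.1 q.2.2.1 q.2.2.2 f)

/-- Supremum norm of a real-valued function. -/
def supN (f : ℝ → ℝ) : ℝ := ⨆ x : ℝ, |f x|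

/-- The constant `C_m[V]`. -/
def CmV (m : ℕ) (V : ℝ → ℝ) : ℝ :=
  ((m : ℝ)^2 + 2*m + m * supN (iteratedDeriv 2 V) + m * |deriv V 0|) +
    2^m * (1+m) * m * (⨆ n ∈ Finset.Icc 2 (m+1), supN (iteratedDeriv n V))

/-- Physicists' Hermite polynomial. -/
def Hpoly (k : ℕ) (y : ℝ) : ℝ :=
  (-1)^k * Real.exp (y^2) * iteratedDeriv k (fun z => Real.exp (-z^2)) y

/-- Hermite function `Φ_k`. -/
def Φh (k : ℕ) (y : ℝ) : ℝ :=
  ((2:ℝ)^k * (Nat.factorial k : ℝ) * Real.sqrt Real.pi) ^ (-(1:ℝ)/2) *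
    Real.exp (-y^2/2) * Hpoly k y

/-- The operator `𝒟 u = ∂_x u + V'(x) u`. -/
def Dop (V : ℝ → ℝ) (u : ℝ → ℂ) (x : ℝ) : ℂ := deriv u x + ((deriv V x : ℝ) : ℂ) * u x

/-- The operator `𝒟* u = −∂_x u + V'(x) u`. -/
def Dstar (V : ℝ → ℝ) (u : ℝ → ℂ) (x : ℝ) : ℂ := -deriv u x + ((deriv V x : ℝ) : ℂ) * u x

/-- The quantum correction `ℰ^ħ(x,y)`. -/
def Eh (hbar : ℝ) (V : ℝ → ℝ) (x y : ℝ) : ℝ :=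
  (V (x + hbar * y / 2) - V (x - hbar * y / 2)) / hbar - deriv V x * y

/-- Matrix elements `ℰ^ħ_{k,l}(x)` of the quantum correction. -/
def Ekl (hbar : ℝ) (V : ℝ → ℝ) (k l : ℕ) (x : ℝ) : ℝ :=
  ∫ y : ℝ, Eh hbar V x y * Φh k y * Φh l y

/-- `t ↦ u(t,·)` is continuously differentiable from `[0,∞)` into `L²(ℝ)` with
derivative `∂_t u`. -/
def C1intoL2one (u : ℝ → ℝ → ℂ) : Prop :=
  ∃ Ψ Ψ' : ℝ → Lp ℂ 2 (volume : Measure ℝ),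
    (∀ t : ℝ, 0 ≤ t → (Ψ t : ℝ → ℂ) =ᵐ[volume] u t) ∧
    (∀ t : ℝ, 0 ≤ t → (Ψ' t : ℝ → ℂ) =ᵐ[volume] fun x => deriv (fun s => u s x) t) ∧
    (∀ t : ℝ, 0 ≤ t → HasDerivWithinAt Ψ (Ψ' t) (Set.Ici 0) t) ∧
    ContinuousOn Ψ' (Set.Ici 0)

/-- Regularity part of the notion of strong solution of a Hermite–Galerkin system of size `N`;
the convention `R_k = 0` for `k > N` is included. -/
def IsGalerkinReg (N : ℕ) (R : ℕ → ℝ → ℝ → ℂ) : Prop :=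
  (∀ k, k ≤ N → ContDiffOn ℝ (⊤ : ℕ∞) (fun p : ℝ × ℝ => R k p.1 p.2) {p : ℝ × ℝ | 0 ≤ p.1}) ∧
  (∀ k, k ≤ N → ∀ t : ℝ, 0 ≤ t → IsSchwartz1 (R k t)) ∧
  (∀ k, k ≤ N → C1intoL2one (R k)) ∧
  (∀ k, N < k → ∀ t x : ℝ, R k t x = 0)

/-- Strong solution of the semiclassical Hermite–Galerkin system of size `N`.
(For `k = 0` the coefficient `√(k/2)` vanishes, so the term `R_{k-1}` is harmless.) -/
def IsSCGalerkinSol (V : ℝ → ℝ) (N : ℕ) (R : ℕ → ℝ → ℝ → ℂ) : Prop :=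
  IsGalerkinReg N R ∧
  ∀ k, k ≤ N → ∀ t : ℝ, 0 ≤ t → ∀ x : ℝ,
    deriv (fun s => R k s x) t +
      Complex.I * ((Real.sqrt ((k : ℝ)/2) : ℂ) * Dop V (R (k-1) t) x +
        (Real.sqrt (((k : ℝ)+1)/2) : ℂ) * Dstar V (R (k+1) t) x) = 0

/-- Strong solution of the von Neumann Hermite–Galerkin system of size `N`. -/
def IsVNGalerkinSol (hbar : ℝ) (V : ℝ → ℝ) (N : ℕ) (R : ℕ → ℝ → ℝ → ℂ) : Prop :=
  IsGalerkinReg N R ∧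
  ∀ k, k ≤ N → ∀ t : ℝ, 0 ≤ t → ∀ x : ℝ,
    deriv (fun s => R k s x) t +
      Complex.I * ((Real.sqrt ((k : ℝ)/2) : ℂ) * Dop V (R (k-1) t) x +
        (Real.sqrt (((k : ℝ)+1)/2) : ℂ) * Dstar V (R (k+1) t) x) =
      -Complex.I * ∑ l ∈ Finset.range (N+1), ((Ekl hbar V k l x : ℝ) : ℂ) * R l t x

/-- Smooth potential with all derivatives of order `≥ 2` bounded. -/
def SmoothBounded (V : ℝ → ℝ) : Prop :=
  ContDiff ℝ (⊤ : ℕ∞) V ∧ ∀ n : ℕ, 2 ≤ n → ∃ C : ℝ, ∀ x : ℝ, |iteratedDeriv n V x| ≤ C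

/-- The harmonic-oscillator operator `A G = y² G − G''`. -/
def Aop (g : ℝ → ℂ) : ℝ → ℂ := fun y => (y : ℂ)^2 * g y - iteratedDeriv 2 g y

/-! ### Mixed partial derivatives of smooth functions of two variables -/

/-- Partial derivative in the first variable. -/
def partialX (f : ℝ → ℝ → ℂ) (x y : ℝ) : ℂ := deriv (fun x' => f x' y) x

/-- Partial derivative in the second variable. -/
def partialY (f : ℝ → ℝ → ℂ) (x y : ℝ) : ℂ := deriv (fun y' => f x y') y

section PartialDerivatives

variable {f : ℝ → ℝ → ℂ}

lemma hasDerivAt_fst_of_contDiff (hf : ContDiff ℝ (⊤ : ℕ∞) (unc f)) (x y : ℝ) :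
    HasDerivAt (fun x' => f x' y) (fderiv ℝ (unc f) (x, y) (1, 0)) x := by
  have h1 : HasFDerivAt (unc f) (fderiv ℝ (unc f) (x, y)) (x, y) :=
    (hf.differentiable (by simp)).differentiableAt.hasFDerivAt
  exact h1.comp_hasDerivAt x ((hasDerivAt_id x).prodMk (hasDerivAt_const x y))

lemma hasDerivAt_snd_of_contDiff (hf : ContDiff ℝ (⊤ : ℕ∞) (unc f)) (x y : ℝ) :
    HasDerivAt (fun y' => f x y') (fderiv ℝ (unc f) (x, y) (0, 1)) y := by
  have h1 : HasFDerivAt (unc f) (fderiv ℝ (unc f) (x, y)) (x, y) :=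
    (hf.differentiable (by simp)).differentiableAt.hasFDerivAt
  exact h1.comp_hasDerivAt y ((hasDerivAt_const y x).prodMk (hasDerivAt_id y))

lemma unc_partialX (hf : ContDiff ℝ (⊤ : ℕ∞) (unc f)) :
    unc (partialX f) = fun p => fderiv ℝ (unc f) p (1, 0) := by
  ext p
  exact (hasDerivAt_fst_of_contDiff hf p.1 p.2).deriv

lemma unc_partialY (hf : ContDiff ℝ (⊤ : ℕ∞) (unc f)) :
    unc (partialY f) = fun p => fderiv ℝ (unc f) p (0, 1) := by
  ext p
  exact (hasDerivAt_snd_of_contDiff hf p.1 p.2).deriv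

lemma contDiff_partialX (hf : ContDiff ℝ (⊤ : ℕ∞) (unc f)) :
    ContDiff ℝ (⊤ : ℕ∞) (unc (partialX f)) := by
  rw [unc_partialX hf]
  exact (hf.fderiv_right (m := (⊤ : ℕ∞)) (by simp)).clm_apply contDiff_const

lemma contDiff_partialY (hf : ContDiff ℝ (⊤ : ℕ∞) (unc f)) :
    ContDiff ℝ (⊤ : ℕ∞) (unc (partialY f)) := by
  rw [unc_partialY hf]
  exact (hf.fderiv_right (m := (⊤ : ℕ∞)) (by simp)).clm_apply contDiff_const

lemma partialX_partialY_comm (hf : ContDiff ℝ (⊤ : ℕ∞) (unc f)) :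
    partialX (partialY f) = partialY (partialX f) := by
  have hd : Differentiable ℝ (fderiv ℝ (unc f)) :=
    (hf.fderiv_right (m := (⊤ : ℕ∞)) (by simp)).differentiable (by simp)
  ext x y
  have h1 := congrFun (unc_partialX (contDiff_partialY hf)) (x, y)
  have h2 := congrFun (unc_partialY (contDiff_partialX hf)) (x, y)
  have h3 : IsSymmSndFDerivAt ℝ (unc f) (x, y) :=
    hf.contDiffAt.isSymmSndFDerivAt (by
      rw [minSmoothness_of_isRCLikeNormedField]; exact WithTop.coe_le_coe.2 (le_top : (2 : ℕ∞) ≤ ⊤))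
  rw [unc_partialY hf] at h1
  rw [unc_partialX hf] at h2
  rw [fderiv_clm_apply hd.differentiableAt (differentiableAt_const _)] at h1 h2
  simp only [fderiv_fun_const, Pi.zero_apply, ContinuousLinearMap.comp_zero, zero_add,
    ContinuousLinearMap.flip_apply] at h1 h2
  exact h1.trans ((h3 _ _).trans h2.symm)

lemma pd2_succ_left (b β : ℕ) (f : ℝ → ℝ → ℂ) : pd2 (b + 1) β f = partialX (pd2 b β f) := by
  ext x y
  simp only [pd2, partialX, iteratedDeriv_succ]

lemma pd2_zero_succ (β : ℕ) (f : ℝ → ℝ → ℂ) : pd2 0 (β + 1) f = partialY (pd2 0 β f) := by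
  ext x y
  simp only [pd2, partialY, iteratedDeriv_succ, iteratedDeriv_zero]

lemma contDiff_pd2 (hf : ContDiff ℝ (⊤ : ℕ∞) (unc f)) (b β : ℕ) :
    ContDiff ℝ (⊤ : ℕ∞) (unc (pd2 b β f)) := by
  induction b with
  | zero =>
    induction β with
    | zero => rwa [show pd2 0 0 f = f by ext; simp [pd2]]
    | succ β ih => rw [pd2_zero_succ]; exact contDiff_partialY ih
  | succ b ih => rw [pd2_succ_left]; exact contDiff_partialX ih

lemma pd2_succ_right (hf : ContDiff ℝ (⊤ : ℕ∞) (unc f)) (b β : ℕ) :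
    pd2 b (β + 1) f = partialY (pd2 b β f) := by
  induction b with
  | zero => exact pd2_zero_succ β f
  | succ b ih =>
    rw [pd2_succ_left, ih, pd2_succ_left, partialX_partialY_comm (contDiff_pd2 hf b β)]

lemma hasDerivAt_pd2_fst (hf : ContDiff ℝ (⊤ : ℕ∞) (unc f)) (b β : ℕ) (x y : ℝ) :
    HasDerivAt (fun x' => pd2 b β f x' y) (pd2 (b + 1) β f x y) x := by
  rw [pd2_succ_left]
  exact (hasDerivAt_fst_of_contDiff (contDiff_pd2 hf b β) x y).differentiableAt.hasDerivAt

lemma hasDerivAt_pd2_snd (hf : ContDiff ℝ (⊤ : ℕ∞) (unc f)) (b β : ℕ) (x y : ℝ) :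
    HasDerivAt (fun y' => pd2 b β f x y') (pd2 b (β + 1) f x y) y := by
  rw [pd2_succ_right hf]
  exact (hasDerivAt_snd_of_contDiff (contDiff_pd2 hf b β) x y).differentiableAt.hasDerivAt

lemma contDiff_slice_fst (hf : ContDiff ℝ (⊤ : ℕ∞) (unc f)) (y : ℝ) :
    ContDiff ℝ (⊤ : ℕ∞) (fun x => f x y) :=
  hf.comp (contDiff_id.prodMk contDiff_const)

lemma contDiff_slice_snd (hf : ContDiff ℝ (⊤ : ℕ∞) (unc f)) (x : ℝ) :
    ContDiff ℝ (⊤ : ℕ∞) (fun y => f x y) :=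
  hf.comp (contDiff_const.prodMk contDiff_id)

lemma iteratedDeriv_pd2_fst (b b' β : ℕ) (f : ℝ → ℝ → ℂ) (x y : ℝ) :
    iteratedDeriv b' (fun x' => pd2 b β f x' y) x = pd2 (b' + b) β f x y := by
  simp only [pd2, iteratedDeriv_eq_iterate, Function.iterate_add_apply]

lemma iteratedDeriv_pd2_snd (hf : ContDiff ℝ (⊤ : ℕ∞) (unc f)) (b β β' : ℕ) (x y : ℝ) :
    iteratedDeriv β' (fun y' => pd2 b β f x y') y = pd2 b (β' + β) f x y := by
  induction β' generalizing y with
  | zero => simp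
  | succ n ih =>
    rw [iteratedDeriv_succ, funext ih, (hasDerivAt_pd2_snd hf b (n + β) x y).deriv]
    congr 1; omega

end PartialDerivatives

/-! ### A differential inequality for sums of norms -/

/-- If each `Ψ q` satisfies `⟪Ψ, Ψ'⟫ ≤ ‖Ψ‖ G` and the sum of the `G q` is controlled by the sum of
the norms, then the sum of the norms grows at most exponentially. -/
lemma sum_norm_le_exp_of_inner_deriv_le {ι E : Type*} [NormedAddCommGroup E]
    [InnerProductSpace ℝ E] (Q : Finset ι) (Ψ Ψ' : ι → ℝ → E) (G : ι → ℝ → ℝ) {C : ℝ}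
    (hC : 0 ≤ C)
    (hd : ∀ q t, 0 ≤ t → HasDerivWithinAt (Ψ q) (Ψ' q t) (Set.Ici 0) t)
    (hG0 : ∀ q ∈ Q, ∀ t, 0 ≤ t → 0 ≤ G q t)
    (hin : ∀ q ∈ Q, ∀ t, 0 ≤ t → inner ℝ (Ψ q t) (Ψ' q t) ≤ ‖Ψ q t‖ * G q t)
    (hG : ∀ t, 0 ≤ t → ∑ q ∈ Q, G q t ≤ C * ∑ q ∈ Q, ‖Ψ q t‖) {t : ℝ} (ht : 0 ≤ t) :
    ∑ q ∈ Q, ‖Ψ q t‖ ≤ (∑ q ∈ Q, ‖Ψ q 0‖) * Real.exp (C * t) := by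
  have key : ∀ ε : ℝ, 0 < ε → ∑ q ∈ Q, ‖Ψ q t‖ ≤
      (∑ q ∈ Q, Real.sqrt (‖Ψ q 0‖ ^ 2 + ε ^ 2)) * Real.exp (C * t) := by
    intro ε hε
    set g : ℝ → ℝ := fun s => ∑ q ∈ Q, Real.sqrt (‖Ψ q s‖ ^ 2 + ε ^ 2) with hg
    have hpos : ∀ q s, 0 < Real.sqrt (‖Ψ q s‖ ^ 2 + ε ^ 2) := fun q s => by positivity
    have hle : ∀ q s, ‖Ψ q s‖ ≤ Real.sqrt (‖Ψ q s‖ ^ 2 + ε ^ 2) := fun q s =>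
      Real.le_sqrt_of_sq_le (by nlinarith)
    have hgd : ∀ s, 0 ≤ s → HasDerivWithinAt g
        (∑ q ∈ Q, inner ℝ (Ψ q s) (Ψ' q s) / Real.sqrt (‖Ψ q s‖ ^ 2 + ε ^ 2)) (Set.Ici 0) s := by
      intro s hs
      refine HasDerivWithinAt.fun_sum fun q _ => ?_
      have h := ((hd q s hs).norm_sq.add_const (ε ^ 2)).sqrt (by positivity)
      rwa [mul_div_mul_left _ _ two_ne_zero] at h
    have hgle : ∀ s, 0 ≤ s →
        ∑ q ∈ Q, inner ℝ (Ψ q s) (Ψ' q s) / Real.sqrt (‖Ψ q s‖ ^ 2 + ε ^ 2) ≤ C * g s := by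
      intro s hs
      calc _ ≤ ∑ q ∈ Q, G q s := by
            refine Finset.sum_le_sum fun q hq => ?_
            rw [div_le_iff₀ (hpos q s), mul_comm]
            exact (hin q hq s hs).trans
              (mul_le_mul_of_nonneg_right (hle q s) (hG0 q hq s hs))
        _ ≤ C * ∑ q ∈ Q, ‖Ψ q s‖ := hG s hs
        _ ≤ C * g s := mul_le_mul_of_nonneg_left (Finset.sum_le_sum fun q _ => hle q s) hC
    have hhd : ∀ s, 0 ≤ s → HasDerivWithinAt (fun s => g s * Real.exp (-(C * s)))
        ((∑ q ∈ Q, inner ℝ (Ψ q s) (Ψ' q s) / Real.sqrt (‖Ψ q s‖ ^ 2 + ε ^ 2)) *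
          Real.exp (-(C * s)) + g s * (Real.exp (-(C * s)) * -(C * 1))) (Set.Ici 0) s :=
      fun s hs => (hgd s hs).mul
        (((hasDerivAt_id s).const_mul C).neg.exp).hasDerivWithinAt
    have hanti : AntitoneOn (fun s => g s * Real.exp (-(C * s))) (Set.Ici 0) := by
      refine antitoneOn_of_deriv_nonpos (convex_Ici 0)
        (fun s hs => (hhd s hs).continuousWithinAt) ?_ ?_
      · exact fun s hs => ((hhd s (interior_subset hs)).mono interior_subset).differentiableWithinAt
      · intro s hs
        rw [interior_Ici] at hs
        rw [((hhd s (le_of_lt hs)).hasDerivAt (Ici_mem_nhds hs)).deriv]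
        have := mul_le_mul_of_nonneg_right (hgle s (le_of_lt hs)) (Real.exp_pos (-(C * s))).le
        linarith
    have h1 : g t * Real.exp (-(C * t)) ≤ g 0 := by
      simpa using hanti (Set.self_mem_Ici) (Set.mem_Ici.2 ht) ht
    calc ∑ q ∈ Q, ‖Ψ q t‖ ≤ g t := Finset.sum_le_sum fun q _ => hle q t
      _ = g t * Real.exp (-(C * t)) * Real.exp (C * t) := by
          rw [mul_assoc, ← Real.exp_add]; simp
      _ ≤ g 0 * Real.exp (C * t) := mul_le_mul_of_nonneg_right h1 (Real.exp_pos _).le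
  have hcont : Continuous fun ε : ℝ =>
      (∑ q ∈ Q, Real.sqrt (‖Ψ q 0‖ ^ 2 + ε ^ 2)) * Real.exp (C * t) := by fun_prop
  have hlim := (hcont.tendsto 0).mono_left (nhdsWithin_le_nhds (s := Set.Ioi 0))
  simp only [ne_eq, OfNat.ofNat_ne_zero, not_false_eq_true, zero_pow, add_zero,
    Real.sqrt_sq (norm_nonneg _)] at hlim
  exact ge_of_tendsto hlim (by filter_upwards [self_mem_nhdsWithin] with ε hε using key ε hε)

/-- A weighted sum along an injective reindexing is bounded by the full sum. -/
lemma sum_weight_mul_comp_le {ι : Type*} (Q : Finset ι) (c u : ι → ℝ) (τ : ι → ι)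
    {K : ℝ} (hK : 0 ≤ K) (hu : ∀ q, 0 ≤ u q) (hc : ∀ q ∈ Q, c q ≤ K)
    (hmaps : ∀ q ∈ Q, c q ≠ 0 → τ q ∈ Q)
    (hinj : ∀ q ∈ Q, c q ≠ 0 → ∀ r ∈ Q, c r ≠ 0 → τ q = τ r → q = r) :
    ∑ q ∈ Q, c q * u (τ q) ≤ K * ∑ q ∈ Q, u q := by
  classical
  calc ∑ q ∈ Q, c q * u (τ q) = ∑ q ∈ Q with c q ≠ 0, c q * u (τ q) := by
        rw [Finset.sum_filter]
        refine Finset.sum_congr rfl fun q _ => ?_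
        split_ifs with h
        · rfl
        · rw [not_not.1 h, zero_mul]
    _ ≤ ∑ q ∈ Q with c q ≠ 0, K * u (τ q) := Finset.sum_le_sum fun q hq =>
        mul_le_mul_of_nonneg_right (hc q (Finset.mem_filter.1 hq).1) (hu _)
    _ = K * ∑ q ∈ (Q.filter fun q => c q ≠ 0).image τ, u q := by
        rw [← Finset.mul_sum, Finset.sum_image]
        intro q hq r hr h
        have hq' := Finset.mem_filter.1 (Finset.mem_coe.1 hq)
        have hr' := Finset.mem_filter.1 (Finset.mem_coe.1 hr)
        exact hinj q hq'.1 hq'.2 r hr'.1 hr'.2 h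
    _ ≤ K * ∑ q ∈ Q, u q := by
        refine mul_le_mul_of_nonneg_left
          (Finset.sum_le_sum_of_subset_of_nonneg ?_ fun q _ _ => hu q) hK
        intro r hr
        obtain ⟨q, hq, rfl⟩ := Finset.mem_image.1 hr
        exact hmaps q (Finset.mem_filter.1 hq).1 (Finset.mem_filter.1 hq).2

/-! ### Skew-adjointness of `i ∂_x ∂_y` -/

lemma integrable_inner_of_memLp_two {F G : ℝ × ℝ → ℂ} (hF : MemLp F 2 volume)
    (hG : MemLp G 2 volume) : Integrable (fun p => inner ℝ (F p) (G p)) volume := by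
  refine (hF.integrable_mul hG).norm.mono'
    (hF.aestronglyMeasurable.inner hG.aestronglyMeasurable) (Filter.Eventually.of_forall fun p => ?_)
  simpa using norm_inner_le_norm (𝕜 := ℝ) (F p) (G p)

lemma inner_real_I_mul_right (z w : ℂ) :
    inner ℝ z (Complex.I * w) = -inner ℝ w (Complex.I * z) := by
  simp [Complex.inner]
  ring

/-- The operator `i ∂_x ∂_y` is skew-adjoint for the real scalar product of `L²(ℝ²)`. -/
lemma integral_inner_I_mul_mixed_deriv_eq_zero {F Fx Fy Fxy : ℝ × ℝ → ℂ}
    (hF : MemLp F 2 volume) (hFx : MemLp Fx 2 volume) (hFy : MemLp Fy 2 volume)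
    (hFxy : MemLp Fxy 2 volume)
    (dx : ∀ p, HasLineDerivAt ℝ F (Fx p) p (1, 0))
    (dy : ∀ p, HasLineDerivAt ℝ F (Fy p) p (0, 1))
    (dyx : ∀ p, HasLineDerivAt ℝ Fy (Fxy p) p (1, 0))
    (dxy : ∀ p, HasLineDerivAt ℝ Fx (Fxy p) p (0, 1)) :
    ∫ p, inner ℝ (F p) (Complex.I * Fxy p) = 0 := by
  have h1 : ∫ p, inner ℝ (F p) (Complex.I * Fxy p) =
      -∫ p, inner ℝ (Fx p) (Complex.I * Fy p) :=
    integral_bilinear_hasLineDerivAt_right_eq_neg_left_of_integrable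
      (B := innerSL ℝ) (v := ((1, 0) : ℝ × ℝ)) (f := F) (g := fun p => Complex.I * Fy p)
      (integrable_inner_of_memLp_two hFx (hFy.const_mul _))
      (integrable_inner_of_memLp_two hF (hFxy.const_mul _))
      (integrable_inner_of_memLp_two hF (hFy.const_mul _))
      (fun p _ => dx p) (fun p _ => HasDerivAt.const_mul Complex.I (dyx p))
  have h2 : ∫ p, inner ℝ (F p) (Complex.I * Fxy p) =
      -∫ p, inner ℝ (Fy p) (Complex.I * Fx p) :=
    integral_bilinear_hasLineDerivAt_right_eq_neg_left_of_integrable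
      (B := innerSL ℝ) (v := ((0, 1) : ℝ × ℝ)) (f := F) (g := fun p => Complex.I * Fx p)
      (integrable_inner_of_memLp_two hFy (hFx.const_mul _))
      (integrable_inner_of_memLp_two hF (hFxy.const_mul _))
      (integrable_inner_of_memLp_two hF (hFx.const_mul _))
      (fun p _ => dy p) (fun p _ => HasDerivAt.const_mul Complex.I (dxy p))
  have h3 : ∫ p, inner ℝ (Fx p) (Complex.I * Fy p) =
      -∫ p, inner ℝ (Fy p) (Complex.I * Fx p) := by
    rw [← integral_neg]
    exact integral_congr_ae (Filter.Eventually.of_forall fun p => inner_real_I_mul_right _ _)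
  linarith

/-! ### Pairing an `L²` function with sums of `L²` functions -/

/-- `∫ ‖F‖ h ≤ ‖F‖ B`, together with integrability of the integrand. -/
def PairingBound (F : ℝ × ℝ → ℂ) (h : ℝ × ℝ → ℝ) (B : ℝ) : Prop :=
  Integrable (fun p => ‖F p‖ * h p) volume ∧
    ∫ p, ‖F p‖ * h p ≤ (eLpNorm F 2 volume).toReal * B

namespace PairingBound

variable {F : ℝ × ℝ → ℂ} {h h₁ h₂ : ℝ × ℝ → ℝ} {B B₁ B₂ : ℝ}

lemma norm {G : ℝ × ℝ → ℂ} (hF : MemLp F 2 volume) (hG : MemLp G 2 volume) :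
    PairingBound F (fun p => ‖G p‖) (eLpNorm G 2 volume).toReal := by
  refine ⟨hF.norm.integrable_mul hG.norm, ?_⟩
  have h := real_inner_le_norm hF.norm.toLp hG.norm.toLp
  rw [L2.inner_def, Lp.norm_toLp, Lp.norm_toLp, eLpNorm_norm, eLpNorm_norm] at h
  refine le_trans (le_of_eq (integral_congr_ae ?_)) h
  filter_upwards [hF.norm.coeFn_toLp, hG.norm.coeFn_toLp] with p h1 h2
  rw [h1, h2]
  simp [mul_comm]

lemma add (H₁ : PairingBound F h₁ B₁) (H₂ : PairingBound F h₂ B₂) :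
    PairingBound F (fun p => h₁ p + h₂ p) (B₁ + B₂) := by
  refine ⟨by simp only [mul_add]; exact H₁.1.add H₂.1, ?_⟩
  simp only [mul_add]
  rw [integral_add H₁.1 H₂.1]
  exact add_le_add H₁.2 H₂.2

lemma const_mul {c : ℝ} (hc : 0 ≤ c) (H : PairingBound F h B) :
    PairingBound F (fun p => c * h p) (c * B) := by
  refine ⟨by simpa only [mul_left_comm] using H.1.const_mul c, ?_⟩
  simp only [mul_left_comm _ c]
  rw [integral_const_mul]
  exact mul_le_mul_of_nonneg_left H.2 hc

lemma sum {ι : Type*} {s : Finset ι} {h : ι → ℝ × ℝ → ℝ} {B : ι → ℝ}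
    (H : ∀ i ∈ s, PairingBound F (h i) (B i)) :
    PairingBound F (fun p => ∑ i ∈ s, h i p) (∑ i ∈ s, B i) := by
  refine ⟨by simpa only [Finset.mul_sum] using integrable_finsetSum s fun i hi => (H i hi).1, ?_⟩
  simp only [Finset.mul_sum]
  rw [integral_finsetSum s fun i hi => (H i hi).1]
  exact Finset.sum_le_sum fun i hi => (H i hi).2

end PairingBound

/-! ### Weighted derivatives -/

section WeightedDerivatives

variable {f : ℝ → ℝ → ℂ}

lemma hasDerivAt_wD_fst (hf : ContDiff ℝ (⊤ : ℕ∞) (unc f)) (a b α β : ℕ) (x y : ℝ) :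
    HasDerivAt (fun x' => wD a b α β f x' y)
      (a * wD (a - 1) b α β f x y + wD a (b + 1) α β f x y) x := by
  have h1 : HasDerivAt (fun x' : ℝ => (x' : ℂ) ^ a) (a * (x : ℂ) ^ (a - 1) * 1) x :=
    (Complex.ofRealCLM.hasDerivAt (x := x)).pow a
  refine HasDerivAt.congr_deriv ((h1.mul_const ((y : ℂ) ^ α)).mul (hasDerivAt_pd2_fst hf b β x y)) ?_
  simp only [wD]
  ring

lemma hasDerivAt_wD_snd (hf : ContDiff ℝ (⊤ : ℕ∞) (unc f)) (a b α β : ℕ) (x y : ℝ) :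
    HasDerivAt (fun y' => wD a b α β f x y')
      (α * wD a b (α - 1) β f x y + wD a b α (β + 1) f x y) y := by
  have h1 : HasDerivAt (fun y' : ℝ => (y' : ℂ) ^ α) (α * (y : ℂ) ^ (α - 1) * 1) y :=
    (Complex.ofRealCLM.hasDerivAt (x := y)).pow α
  refine HasDerivAt.congr_deriv ((h1.const_mul ((x : ℂ) ^ a)).mul (hasDerivAt_pd2_snd hf b β x y)) ?_
  simp only [wD]
  ring

lemma hasLineDerivAt_fst_of_hasDerivAt {g g' : ℝ → ℝ → ℂ}
    (h : ∀ x y, HasDerivAt (fun x' => g x' y) (g' x y) x) (p : ℝ × ℝ) :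
    HasLineDerivAt ℝ (unc g) (unc g' p) p (1, 0) := by
  have h1 : HasDerivAt (fun t : ℝ => p.1 + t) 1 0 := (hasDerivAt_id 0).const_add _
  have h2 : HasDerivAt (fun x' => g x' p.2) (g' p.1 p.2) (p.1 + 0) := by
    simpa using h p.1 p.2
  have h3 := h2.scomp (0 : ℝ) h1
  simpa [HasLineDerivAt, unc, Function.comp_def] using h3

lemma hasLineDerivAt_snd_of_hasDerivAt {g g' : ℝ → ℝ → ℂ}
    (h : ∀ x y, HasDerivAt (fun y' => g x y') (g' x y) y) (p : ℝ × ℝ) :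
    HasLineDerivAt ℝ (unc g) (unc g' p) p (0, 1) := by
  have h1 : HasDerivAt (fun t : ℝ => p.2 + t) 1 0 := (hasDerivAt_id 0).const_add _
  have h2 : HasDerivAt (fun y' => g p.1 y') (g' p.1 p.2) (p.2 + 0) := by
    simpa using h p.1 p.2
  have h3 := h2.scomp (0 : ℝ) h1
  simpa [HasLineDerivAt, unc, Function.comp_def] using h3

/-- The expansion of `∂_x ∂_y (x^a y^α ∂_x^b ∂_y^β f)` in weighted derivatives. -/
def mixedWD (a b α β : ℕ) (f : ℝ → ℝ → ℂ) (x y : ℝ) : ℂ :=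
  a * α * wD (a - 1) b (α - 1) β f x y + a * wD (a - 1) b α (β + 1) f x y +
    α * wD a (b + 1) (α - 1) β f x y + wD a (b + 1) α (β + 1) f x y

lemma integral_inner_wD_I_mul_mixedWD (hf : ContDiff ℝ (⊤ : ℕ∞) (unc f))
    (hL : ∀ a b α β, MemLp (unc (wD a b α β f)) 2 volume) (a b α β : ℕ) :
    MemLp (unc (mixedWD a b α β f)) 2 volume ∧
      ∫ p, inner ℝ (unc (wD a b α β f) p) (Complex.I * unc (mixedWD a b α β f) p) = 0 := by
  have hxy : MemLp (unc (mixedWD a b α β f)) 2 volume :=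
    ((((hL _ _ _ _).const_mul _).add ((hL _ _ _ _).const_mul _)).add
      ((hL _ _ _ _).const_mul _)).add (hL _ _ _ _)
  refine ⟨hxy, ?_⟩
  let fx : ℝ → ℝ → ℂ := fun x y => a * wD (a - 1) b α β f x y + wD a (b + 1) α β f x y
  let fy : ℝ → ℝ → ℂ := fun x y => α * wD a b (α - 1) β f x y + wD a b α (β + 1) f x y
  have hx : MemLp (unc fx) 2 volume := ((hL _ _ _ _).const_mul _).add (hL _ _ _ _)
  have hy : MemLp (unc fy) 2 volume := ((hL _ _ _ _).const_mul _).add (hL _ _ _ _)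
  refine integral_inner_I_mul_mixed_deriv_eq_zero (hL a b α β) hx hy hxy
    (hasLineDerivAt_fst_of_hasDerivAt (hasDerivAt_wD_fst hf a b α β))
    (hasLineDerivAt_snd_of_hasDerivAt (hasDerivAt_wD_snd hf a b α β))
    (hasLineDerivAt_fst_of_hasDerivAt fun x y => ?_)
    (hasLineDerivAt_snd_of_hasDerivAt fun x y => ?_)
  · refine HasDerivAt.congr_deriv (((hasDerivAt_wD_fst hf a b (α - 1) β x y).const_mul (α : ℂ)).add
      (hasDerivAt_wD_fst hf a b α (β + 1) x y)) ?_
    simp only [mixedWD]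
    ring
  · refine HasDerivAt.congr_deriv (((hasDerivAt_wD_snd hf (a - 1) b α β x y).const_mul (a : ℂ)).add
      (hasDerivAt_wD_snd hf a (b + 1) α β x y)) ?_
    simp only [mixedWD]
    ring

end WeightedDerivatives

/-! ### The weighted derivatives of the right-hand side -/

lemma iteratedDeriv_ofReal_comp {g : ℝ → ℝ} {m : ℕ} (hg : ContDiff ℝ m g) {j : ℕ} (hj : j ≤ m)
    (x : ℝ) : iteratedDeriv j (fun x => (g x : ℂ)) x = ((iteratedDeriv j g x : ℝ) : ℂ) := by
  induction j generalizing x with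
  | zero => simp
  | succ j ih =>
    rw [iteratedDeriv_succ, iteratedDeriv_succ, funext (ih (by omega))]
    have := (hg.differentiable_iteratedDeriv j (by exact_mod_cast hj)) x
    exact this.hasDerivAt.ofReal_comp.deriv

lemma iteratedDeriv_ofReal_mul {f : ℝ → ℝ → ℂ} (hf : ContDiff ℝ (⊤ : ℕ∞) (unc f)) (β : ℕ)
    (x y : ℝ) : iteratedDeriv β (fun y' : ℝ => (y' : ℂ) * f x y') y =
      y * pd2 0 β f x y + β * pd2 0 (β - 1) f x y := by
  induction β generalizing y with
  | zero => simp [pd2]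
  | succ n ih =>
    rw [iteratedDeriv_succ, funext ih]
    have h1 : HasDerivAt (fun y' : ℝ => (y' : ℂ)) 1 y := Complex.ofRealCLM.hasDerivAt (x := y)
    have h2 := (h1.mul (hasDerivAt_pd2_snd hf 0 n x y)).add
      ((hasDerivAt_pd2_snd hf 0 (n - 1) x y).const_mul (n : ℂ))
    refine h2.deriv.trans ?_
    rcases n with _ | n
    · simp; ring
    · simp; ring

lemma contDiffAt_pd2_fst {f : ℝ → ℝ → ℂ} (hf : ContDiff ℝ (⊤ : ℕ∞) (unc f)) (n b β : ℕ)
    (x y : ℝ) : ContDiffAt ℝ n (fun x' => pd2 b β f x' y) x :=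
  ((contDiff_slice_fst (contDiff_pd2 hf b β) y).of_le
    (by exact_mod_cast (le_top : (n : ℕ∞) ≤ ⊤))).contDiffAt

lemma contDiffAt_pd2_snd {f : ℝ → ℝ → ℂ} (hf : ContDiff ℝ (⊤ : ℕ∞) (unc f)) (n b β : ℕ)
    (x y : ℝ) : ContDiffAt ℝ n (fun y' => pd2 b β f x y') y :=
  ((contDiff_slice_snd (contDiff_pd2 hf b β) x).of_le
    (by exact_mod_cast (le_top : (n : ℕ∞) ≤ ⊤))).contDiffAt

/-- Leibniz formula for the mixed derivatives of the right-hand side of the semiclassical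
equation. -/
lemma pd2_semiclassical_rhs {m : ℕ} {V : ℝ → ℝ} (hV : ContDiff ℝ m (deriv V))
    {f g : ℝ → ℝ → ℂ} (hf : ContDiff ℝ (⊤ : ℕ∞) (unc f))
    (hg : ∀ x y, g x y = Complex.I * pd2 1 1 f x y -
      Complex.I * ((deriv V x * y : ℝ) : ℂ) * f x y)
    {b : ℕ} (hb : b ≤ m) (β : ℕ) (x y : ℝ) :
    pd2 b β g x y = Complex.I * pd2 (b + 1) (β + 1) f x y -
      Complex.I * ∑ j ∈ Finset.range (b + 1),
        (b.choose j : ℂ) * ((iteratedDeriv (j + 1) V x : ℝ) : ℂ) *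
          (y * pd2 (b - j) β f x y + β * pd2 (b - j) (β - 1) f x y) := by
  have hf0 : pd2 0 0 f = f := by ext; simp [pd2]
  have hVc : ContDiff ℝ m fun x => ((deriv V x : ℝ) : ℂ) := Complex.ofRealCLM.contDiff.comp hV
  have h1 : ∀ x', iteratedDeriv β (fun y' => g x' y') y =
      Complex.I * pd2 1 (β + 1) f x' y - Complex.I * (((deriv V x' : ℝ) : ℂ) *
        (y * pd2 0 β f x' y + β * pd2 0 (β - 1) f x' y)) := by
    intro x'
    have e : (fun y' => g x' y') = fun y' => Complex.I * pd2 1 1 f x' y' -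
        (Complex.I * ((deriv V x' : ℝ) : ℂ)) * ((y' : ℂ) * f x' y') := by
      ext y'
      rw [hg]
      push_cast
      ring
    have hc : ContDiffAt ℝ β (fun y' : ℝ => (y' : ℂ) * f x' y') y := by
      have := contDiffAt_pd2_snd hf β 0 0 x' y
      rw [hf0] at this
      exact Complex.ofRealCLM.contDiff.contDiffAt.mul this
    rw [e, iteratedDeriv_fun_sub (contDiffAt_const.mul (contDiffAt_pd2_snd hf β 1 1 x' y))
      (contDiffAt_const.mul hc), iteratedDeriv_const_mul_field, iteratedDeriv_const_mul_field,
      iteratedDeriv_pd2_snd hf, iteratedDeriv_ofReal_mul hf]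
    ring
  have hbV : ContDiffAt ℝ b (fun x => ((deriv V x : ℝ) : ℂ)) x :=
    (hVc.of_le (by exact_mod_cast hb)).contDiffAt
  have hin : ∀ n : ℕ, ContDiffAt ℝ n
      (fun x' => (y : ℂ) * pd2 0 β f x' y + β * pd2 0 (β - 1) f x' y) x := fun n =>
    (contDiffAt_const.mul (contDiffAt_pd2_fst hf n 0 β x y)).add
      (contDiffAt_const.mul (contDiffAt_pd2_fst hf n 0 (β - 1) x y))
  rw [pd2, funext h1, iteratedDeriv_fun_sub
    (contDiffAt_const.mul (contDiffAt_pd2_fst hf b 1 (β + 1) x y))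
    (contDiffAt_const.mul (hbV.mul (hin b))), iteratedDeriv_const_mul_field,
    iteratedDeriv_const_mul_field, iteratedDeriv_pd2_fst, iteratedDeriv_fun_mul hbV (hin b)]
  congr 2
  refine Finset.sum_congr rfl fun j hj => ?_
  have hj' : j ≤ b := Nat.lt_succ_iff.1 (Finset.mem_range.1 hj)
  rw [iteratedDeriv_ofReal_comp hV (hj'.trans hb), iteratedDeriv_succ',
    iteratedDeriv_fun_add (contDiffAt_const.mul (contDiffAt_pd2_fst hf _ 0 β x y))
      (contDiffAt_const.mul (contDiffAt_pd2_fst hf _ 0 (β - 1) x y)),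
    iteratedDeriv_const_mul_field, iteratedDeriv_const_mul_field, iteratedDeriv_pd2_fst,
    iteratedDeriv_pd2_fst, add_zero]

/-! ### The energy estimate -/

/-- The quantity controlling the growth of the norm of `x^a ∂_x^b y^α ∂_y^β S`, where
`q = (a, b, α, β)`, in terms of the family `u` of sizes of the weighted derivatives of `S`. -/
def growthBound (m : ℕ) (v₀ v₂ M : ℝ) (u : ℕ × ℕ × ℕ × ℕ → ℝ) : ℕ × ℕ × ℕ × ℕ → ℝ :=
  fun (a, b, α, β) =>
    (a * α : ℝ) * u (a - 1, b, α - 1, β) + (a : ℝ) * u (a - 1, b, α, β + 1) +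
      (α : ℝ) * u (a, b + 1, α - 1, β) + (β * v₀ : ℝ) * u (a, b, α, β - 1) +
      (β * v₂ : ℝ) * u (a + 1, b, α, β - 1) +
      ∑ j ∈ Finset.range m, ((b.choose (j + 1) * M : ℝ) * u (a, b - (j + 1), α + 1, β) +
        (β * (b.choose (j + 1) * M) : ℝ) * u (a, b - (j + 1), α, β - 1))

lemma growthBound_nonneg {m : ℕ} {v₀ v₂ M : ℝ} {u : ℕ × ℕ × ℕ × ℕ → ℝ} (h₀ : 0 ≤ v₀)
    (h₂ : 0 ≤ v₂) (hM : 0 ≤ M) (hu : ∀ q, 0 ≤ u q) (q : ℕ × ℕ × ℕ × ℕ) :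
    0 ≤ growthBound m v₀ v₂ M u q := by
  obtain ⟨a, b, α, β⟩ := q
  have hs : 0 ≤ ∑ j ∈ Finset.range m, ((b.choose (j + 1) * M : ℝ) * u (a, b - (j + 1), α + 1, β) +
        (β * (b.choose (j + 1) * M) : ℝ) * u (a, b - (j + 1), α, β - 1)) :=
    Finset.sum_nonneg fun j _ => by
      have := hu (a, b - (j + 1), α + 1, β)
      have := hu (a, b - (j + 1), α, β - 1)
      positivity
  have := hu (a - 1, b, α - 1, β)
  have := hu (a - 1, b, α, β + 1)
  have := hu (a, b + 1, α - 1, β)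
  have := hu (a, b, α, β - 1)
  have := hu (a + 1, b, α, β - 1)
  simp only [growthBound]
  positivity

/-- The weights `(a, b, α, β)` entering `𝒩_m`. -/
def weights (m : ℕ) : Finset (ℕ × ℕ × ℕ × ℕ) :=
  Finset.filter (fun q : ℕ × ℕ × ℕ × ℕ => q.1 + q.2.1 + q.2.2.1 + q.2.2.2 ≤ m)
    (Finset.range (m+1) ×ˢ Finset.range (m+1) ×ˢ Finset.range (m+1) ×ˢ Finset.range (m+1))

lemma mem_weights {m a b α β : ℕ} : (a, b, α, β) ∈ weights m ↔ a + b + α + β ≤ m := by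
  simp only [weights, Finset.mem_filter, Finset.mem_product, Finset.mem_range]
  omega

lemma sum_growthBound_le {m : ℕ} {v₀ v₂ M : ℝ} {u : ℕ × ℕ × ℕ × ℕ → ℝ} (h₀ : 0 ≤ v₀)
    (h₂ : 0 ≤ v₂) (hM : 0 ≤ M) (hu : ∀ q, 0 ≤ u q) :
    ∑ q ∈ weights m, growthBound m v₀ v₂ M u q ≤
      ((m : ℝ) ^ 2 + 2 * m + m * v₂ + m * v₀ + 2 ^ m * (1 + m) * m * M) *
        ∑ q ∈ weights m, u q := by
  have hch : ∀ {b j : ℕ}, b ≤ m → (b.choose j : ℝ) ≤ 2 ^ m := fun {b j} hb => by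
    exact_mod_cast (Nat.choose_le_two_pow b j).trans (Nat.pow_le_pow_right two_pos hb)
  have T1 : ∑ q ∈ weights m, (q.1 * q.2.2.1 : ℝ) * u (q.1 - 1, q.2.1, q.2.2.1 - 1, q.2.2.2) ≤
      (m : ℝ) ^ 2 * ∑ q ∈ weights m, u q := by
    refine sum_weight_mul_comp_le _ _ u (fun q => (q.1 - 1, q.2.1, q.2.2.1 - 1, q.2.2.2))
      (by positivity) hu ?_ ?_ ?_
    · rintro ⟨a, b, α, β⟩ hq
      have := mem_weights.1 hq
      have ha : (a : ℝ) ≤ m := by exact_mod_cast (by omega : a ≤ m)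
      have hα : (α : ℝ) ≤ m := by exact_mod_cast (by omega : α ≤ m)
      rw [sq]
      exact mul_le_mul ha hα (by positivity) (by positivity)
    · rintro ⟨a, b, α, β⟩ hq -
      have := mem_weights.1 hq
      exact mem_weights.2 (by dsimp only; omega)
    · rintro ⟨a, b, α, β⟩ - hc ⟨a', b', α', β'⟩ - hc' h
      simp only [ne_eq, mul_eq_zero, Nat.cast_eq_zero, not_or] at hc hc'
      simp only [Prod.mk.injEq] at h ⊢
      omega
  have T2 : ∑ q ∈ weights m, (q.1 : ℝ) * u (q.1 - 1, q.2.1, q.2.2.1, q.2.2.2 + 1) ≤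
      (m : ℝ) * ∑ q ∈ weights m, u q := by
    refine sum_weight_mul_comp_le _ _ u (fun q => (q.1 - 1, q.2.1, q.2.2.1, q.2.2.2 + 1))
      (by positivity) hu ?_ ?_ ?_
    · rintro ⟨a, b, α, β⟩ hq
      have := mem_weights.1 hq
      exact_mod_cast (by omega : a ≤ m)
    · rintro ⟨a, b, α, β⟩ hq hc
      have := mem_weights.1 hq
      simp only [ne_eq, Nat.cast_eq_zero] at hc
      exact mem_weights.2 (by dsimp only; omega)
    · rintro ⟨a, b, α, β⟩ - hc ⟨a', b', α', β'⟩ - hc' h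
      simp only [ne_eq, Nat.cast_eq_zero] at hc hc'
      simp only [Prod.mk.injEq] at h ⊢
      omega
  have T3 : ∑ q ∈ weights m, (q.2.2.1 : ℝ) * u (q.1, q.2.1 + 1, q.2.2.1 - 1, q.2.2.2) ≤
      (m : ℝ) * ∑ q ∈ weights m, u q := by
    refine sum_weight_mul_comp_le _ _ u (fun q => (q.1, q.2.1 + 1, q.2.2.1 - 1, q.2.2.2))
      (by positivity) hu ?_ ?_ ?_
    · rintro ⟨a, b, α, β⟩ hq
      have := mem_weights.1 hq
      exact_mod_cast (by omega : α ≤ m)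
    · rintro ⟨a, b, α, β⟩ hq hc
      have := mem_weights.1 hq
      simp only [ne_eq, Nat.cast_eq_zero] at hc
      exact mem_weights.2 (by dsimp only; omega)
    · rintro ⟨a, b, α, β⟩ - hc ⟨a', b', α', β'⟩ - hc' h
      simp only [ne_eq, Nat.cast_eq_zero] at hc hc'
      simp only [Prod.mk.injEq] at h ⊢
      omega
  have T4 : ∑ q ∈ weights m, (q.2.2.2 * v₀ : ℝ) * u (q.1, q.2.1, q.2.2.1, q.2.2.2 - 1) ≤
      (m * v₀) * ∑ q ∈ weights m, u q := by
    refine sum_weight_mul_comp_le _ _ u (fun q => (q.1, q.2.1, q.2.2.1, q.2.2.2 - 1))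
      (by positivity) hu ?_ ?_ ?_
    · rintro ⟨a, b, α, β⟩ hq
      have := mem_weights.1 hq
      exact mul_le_mul_of_nonneg_right (by exact_mod_cast (by omega : β ≤ m)) h₀
    · rintro ⟨a, b, α, β⟩ hq -
      have := mem_weights.1 hq
      exact mem_weights.2 (by dsimp only; omega)
    · rintro ⟨a, b, α, β⟩ - hc ⟨a', b', α', β'⟩ - hc' h
      simp only [ne_eq, mul_eq_zero, Nat.cast_eq_zero, not_or] at hc hc'
      simp only [Prod.mk.injEq] at h ⊢
      omega
  have T5 : ∑ q ∈ weights m, (q.2.2.2 * v₂ : ℝ) * u (q.1 + 1, q.2.1, q.2.2.1, q.2.2.2 - 1) ≤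
      (m * v₂) * ∑ q ∈ weights m, u q := by
    refine sum_weight_mul_comp_le _ _ u (fun q => (q.1 + 1, q.2.1, q.2.2.1, q.2.2.2 - 1))
      (by positivity) hu ?_ ?_ ?_
    · rintro ⟨a, b, α, β⟩ hq
      have := mem_weights.1 hq
      exact mul_le_mul_of_nonneg_right (by exact_mod_cast (by omega : β ≤ m)) h₂
    · rintro ⟨a, b, α, β⟩ hq hc
      have := mem_weights.1 hq
      simp only [ne_eq, mul_eq_zero, Nat.cast_eq_zero, not_or] at hc
      exact mem_weights.2 (by dsimp only; omega)
    · rintro ⟨a, b, α, β⟩ - hc ⟨a', b', α', β'⟩ - hc' h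
      simp only [ne_eq, mul_eq_zero, Nat.cast_eq_zero, not_or] at hc hc'
      simp only [Prod.mk.injEq] at h ⊢
      omega
  have T6 : ∀ j ∈ Finset.range m, ∑ q ∈ weights m, (q.2.1.choose (j + 1) * M : ℝ) *
      u (q.1, q.2.1 - (j + 1), q.2.2.1 + 1, q.2.2.2) ≤ (2 ^ m * M) * ∑ q ∈ weights m, u q := by
    intro j _
    refine sum_weight_mul_comp_le _ _ u
      (fun q => (q.1, q.2.1 - (j + 1), q.2.2.1 + 1, q.2.2.2)) (by positivity) hu ?_ ?_ ?_
    · rintro ⟨a, b, α, β⟩ hq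
      have := mem_weights.1 hq
      exact mul_le_mul_of_nonneg_right (hch (b := b) (by omega)) hM
    · rintro ⟨a, b, α, β⟩ hq hc
      have := mem_weights.1 hq
      simp only [ne_eq, mul_eq_zero, Nat.cast_eq_zero, not_or, Nat.choose_eq_zero_iff] at hc
      exact mem_weights.2 (by dsimp only; omega)
    · rintro ⟨a, b, α, β⟩ - hc ⟨a', b', α', β'⟩ - hc' h
      simp only [ne_eq, mul_eq_zero, Nat.cast_eq_zero, not_or, Nat.choose_eq_zero_iff] at hc hc'
      simp only [Prod.mk.injEq] at h ⊢
      omega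
  have T7 : ∀ j ∈ Finset.range m, ∑ q ∈ weights m, (q.2.2.2 * (q.2.1.choose (j + 1) * M) : ℝ) *
      u (q.1, q.2.1 - (j + 1), q.2.2.1, q.2.2.2 - 1) ≤
        (m * (2 ^ m * M)) * ∑ q ∈ weights m, u q := by
    intro j _
    refine sum_weight_mul_comp_le _ _ u
      (fun q => (q.1, q.2.1 - (j + 1), q.2.2.1, q.2.2.2 - 1)) (by positivity) hu ?_ ?_ ?_
    · rintro ⟨a, b, α, β⟩ hq
      have := mem_weights.1 hq
      exact mul_le_mul (by exact_mod_cast (by omega : β ≤ m))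
        (mul_le_mul_of_nonneg_right (hch (b := b) (by omega)) hM) (by positivity) (by positivity)
    · rintro ⟨a, b, α, β⟩ hq -
      have := mem_weights.1 hq
      exact mem_weights.2 (by dsimp only; omega)
    · rintro ⟨a, b, α, β⟩ - hc ⟨a', b', α', β'⟩ - hc' h
      simp only [ne_eq, mul_eq_zero, Nat.cast_eq_zero, not_or, Nat.choose_eq_zero_iff] at hc hc'
      simp only [Prod.mk.injEq] at h ⊢
      omega
  have T6' := Finset.sum_le_sum T6
  have T7' := Finset.sum_le_sum T7
  rw [Finset.sum_const, Finset.card_range, nsmul_eq_mul, Finset.sum_comm] at T6' T7'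
  simp only [growthBound, Finset.sum_add_distrib]
  linarith

section EnergyEstimate

variable {m : ℕ} {V : ℝ → ℝ} {v₀ v₂ M : ℝ} {f g : ℝ → ℝ → ℂ}

/-- Up to terms that are skew-adjoint, a weighted derivative of the right-hand side of the
semiclassical equation is controlled pointwise by `growthBound`. -/
lemma norm_wD_semiclassical_rhs_sub_le (hV : ContDiff ℝ m (deriv V))
    (hf : ContDiff ℝ (⊤ : ℕ∞) (unc f))
    (hg : ∀ x y, g x y = Complex.I * pd2 1 1 f x y -
      Complex.I * ((deriv V x * y : ℝ) : ℂ) * f x y)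
    (hM0 : 0 ≤ M) (hV1 : ∀ x, |deriv V x| ≤ v₀ + v₂ * |x|)
    (hVM : ∀ j < m, ∀ x, |iteratedDeriv (j + 2) V x| ≤ M)
    {a b α β : ℕ} (hb : b ≤ m) (x y : ℝ) :
    ‖wD a b α β g x y - (Complex.I * mixedWD a b α β f x y -
        Complex.I * (((deriv V x * y : ℝ) : ℂ) * wD a b α β f x y))‖ ≤
      growthBound m v₀ v₂ M (fun q => ‖wD q.1 q.2.1 q.2.2.1 q.2.2.2 f x y‖) (a, b, α, β) := by
  have key : wD a b α β g x y - (Complex.I * mixedWD a b α β f x y -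
        Complex.I * (((deriv V x * y : ℝ) : ℂ) * wD a b α β f x y)) =
      -Complex.I * ((a : ℂ) * α * wD (a - 1) b (α - 1) β f x y +
        a * wD (a - 1) b α (β + 1) f x y + α * wD a (b + 1) (α - 1) β f x y +
        β * ((deriv V x : ℝ) : ℂ) * wD a b α (β - 1) f x y +
        ∑ j ∈ Finset.range b, ((b.choose (j + 1) : ℂ) * ((iteratedDeriv (j + 2) V x : ℝ) : ℂ) *
          wD a (b - (j + 1)) (α + 1) β f x y + (β : ℂ) * ((b.choose (j + 1) : ℂ) *
          ((iteratedDeriv (j + 2) V x : ℝ) : ℂ)) * wD a (b - (j + 1)) α (β - 1) f x y)) := by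
    have hs : ∑ j ∈ Finset.range b, ((b.choose (j + 1) : ℂ) *
          ((iteratedDeriv (j + 2) V x : ℝ) : ℂ) *
          wD a (b - (j + 1)) (α + 1) β f x y + (β : ℂ) * ((b.choose (j + 1) : ℂ) *
          ((iteratedDeriv (j + 2) V x : ℝ) : ℂ)) * wD a (b - (j + 1)) α (β - 1) f x y) =
        (x : ℂ) ^ a * (y : ℂ) ^ α * ∑ j ∈ Finset.range b,
          (b.choose (j + 1) : ℂ) * ((iteratedDeriv (j + 1 + 1) V x : ℝ) : ℂ) *
          (y * pd2 (b - (j + 1)) β f x y + β * pd2 (b - (j + 1)) (β - 1) f x y) := by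
      rw [Finset.mul_sum]
      refine Finset.sum_congr rfl fun j _ => ?_
      simp only [wD]
      ring
    rw [hs]
    simp only [mixedWD]
    rw [wD, pd2_semiclassical_rhs hV hf hg hb, Finset.sum_range_succ']
    simp only [wD, Nat.choose_zero_right, Nat.cast_one, zero_add, iteratedDeriv_one, Nat.sub_zero]
    push_cast
    ring
  rw [key, norm_mul, norm_neg, Complex.norm_I, one_mul]
  have hpot : ‖(β : ℂ) * ((deriv V x : ℝ) : ℂ) * wD a b α (β - 1) f x y‖ ≤
      (β * v₀ : ℝ) * ‖wD a b α (β - 1) f x y‖ + (β * v₂ : ℝ) * ‖wD (a + 1) b α (β - 1) f x y‖ := by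
    have hx : ‖wD (a + 1) b α (β - 1) f x y‖ = |x| * ‖wD a b α (β - 1) f x y‖ := by
      simp only [wD, norm_mul, norm_pow, Complex.norm_real, Real.norm_eq_abs]
      ring
    rw [norm_mul, norm_mul, Complex.norm_natCast, Complex.norm_real, Real.norm_eq_abs, hx]
    have := mul_le_mul_of_nonneg_right (mul_le_mul_of_nonneg_left (hV1 x) (Nat.cast_nonneg β))
      (norm_nonneg (wD a b α (β - 1) f x y))
    linarith
  have hsum : ‖∑ j ∈ Finset.range b, ((b.choose (j + 1) : ℂ) *
        ((iteratedDeriv (j + 2) V x : ℝ) : ℂ) *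
        wD a (b - (j + 1)) (α + 1) β f x y + (β : ℂ) * ((b.choose (j + 1) : ℂ) *
        ((iteratedDeriv (j + 2) V x : ℝ) : ℂ)) * wD a (b - (j + 1)) α (β - 1) f x y)‖ ≤
      ∑ j ∈ Finset.range m, ((b.choose (j + 1) * M : ℝ) * ‖wD a (b - (j + 1)) (α + 1) β f x y‖ +
        (β * (b.choose (j + 1) * M) : ℝ) * ‖wD a (b - (j + 1)) α (β - 1) f x y‖) := by
    refine (norm_sum_le_of_le _ fun j hj => ?_).trans
      (Finset.sum_le_sum_of_subset_of_nonneg (Finset.range_subset_range.2 hb)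
        fun j _ _ => by positivity)
    have hjM := hVM j ((Finset.mem_range.1 hj).trans_le hb) x
    refine (norm_add_le _ _).trans ?_
    simp only [norm_mul, Complex.norm_natCast, Complex.norm_real, Real.norm_eq_abs]
    gcongr
  have h3 : ‖(a : ℂ) * α * wD (a - 1) b (α - 1) β f x y +
        a * wD (a - 1) b α (β + 1) f x y + α * wD a (b + 1) (α - 1) β f x y‖ ≤
      (a * α : ℝ) * ‖wD (a - 1) b (α - 1) β f x y‖ + a * ‖wD (a - 1) b α (β + 1) f x y‖ +
        α * ‖wD a (b + 1) (α - 1) β f x y‖ := by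
    refine norm_add₃_le.trans (le_of_eq ?_)
    simp only [norm_mul, Complex.norm_natCast]
  simp only [growthBound]
  refine norm_add₃_le.trans ?_
  linarith

lemma inner_real_I_mul_ofReal_mul_self (r : ℝ) (z : ℂ) :
    inner ℝ z (Complex.I * ((r : ℂ) * z)) = 0 := by
  simp [Complex.inner]
  ring

/-- The energy estimate for a weighted derivative. -/
lemma integral_inner_wD_semiclassical_rhs_le (hV : ContDiff ℝ m (deriv V))
    (hf : ContDiff ℝ (⊤ : ℕ∞) (unc f))
    (hL : ∀ a b α β, MemLp (unc (wD a b α β f)) 2 volume)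
    (hg : ∀ x y, g x y = Complex.I * pd2 1 1 f x y -
      Complex.I * ((deriv V x * y : ℝ) : ℂ) * f x y)
    (h₀ : 0 ≤ v₀) (h₂ : 0 ≤ v₂) (hM0 : 0 ≤ M) (hV1 : ∀ x, |deriv V x| ≤ v₀ + v₂ * |x|)
    (hVM : ∀ j < m, ∀ x, |iteratedDeriv (j + 2) V x| ≤ M)
    {a b α β : ℕ} (hb : b ≤ m) (hgL : MemLp (unc (wD a b α β g)) 2 volume) :
    ∫ p, inner ℝ (unc (wD a b α β f) p) (unc (wD a b α β g) p) ≤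
      L2 (wD a b α β f) *
        growthBound m v₀ v₂ M (fun q => L2 (wD q.1 q.2.1 q.2.2.1 q.2.2.2 f)) (a, b, α, β) := by
  have hterm : ∀ (c : ℝ) (a' b' α' β' : ℕ), 0 ≤ c → PairingBound (unc (wD a b α β f))
      (fun p => c * ‖wD a' b' α' β' f p.1 p.2‖) (c * L2 (wD a' b' α' β' f)) :=
    fun c a' b' α' β' hc => (PairingBound.norm (hL a b α β) (hL a' b' α' β')).const_mul hc
  have hB : PairingBound (unc (wD a b α β f)) (fun p => growthBound m v₀ v₂ M
      (fun q => ‖wD q.1 q.2.1 q.2.2.1 q.2.2.2 f p.1 p.2‖) (a, b, α, β))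
      (growthBound m v₀ v₂ M (fun q => L2 (wD q.1 q.2.1 q.2.2.1 q.2.2.2 f)) (a, b, α, β)) := by
    simp only [growthBound]
    exact (((((hterm _ _ _ _ _ (by positivity)).add (hterm _ _ _ _ _ (by positivity))).add
      (hterm _ _ _ _ _ (by positivity))).add (hterm _ _ _ _ _ (by positivity))).add
      (hterm _ _ _ _ _ (by positivity))).add (PairingBound.sum fun j _ =>
        (hterm _ _ _ _ _ (by positivity)).add (hterm _ _ _ _ _ (by positivity)))
  obtain ⟨hmL, hm0⟩ := integral_inner_wD_I_mul_mixedWD hf hL a b α β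
  have hint := integrable_inner_of_memLp_two (hL a b α β) (hmL.const_mul Complex.I)
  calc ∫ p, inner ℝ (unc (wD a b α β f) p) (unc (wD a b α β g) p)
      ≤ ∫ p, (inner ℝ (unc (wD a b α β f) p) (Complex.I * unc (mixedWD a b α β f) p) +
          ‖unc (wD a b α β f) p‖ * growthBound m v₀ v₂ M
            (fun q => ‖wD q.1 q.2.1 q.2.2.1 q.2.2.2 f p.1 p.2‖) (a, b, α, β)) := by
        refine integral_mono (integrable_inner_of_memLp_two (hL a b α β) hgL)
          (hint.add hB.1) fun p => ?_
        have h1 := (real_inner_le_norm (wD a b α β f p.1 p.2) _).trans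
          (mul_le_mul_of_nonneg_left (norm_wD_semiclassical_rhs_sub_le hV hf hg hM0 hV1 hVM
            (a := a) (α := α) (β := β) hb p.1 p.2) (norm_nonneg (wD a b α β f p.1 p.2)))
        rw [inner_sub_right, inner_sub_right, inner_real_I_mul_ofReal_mul_self, sub_zero] at h1
        simp only [unc]
        linarith
    _ ≤ _ := by
        rw [integral_add hint hB.1, hm0, zero_add]
        exact hB.2

end EnergyEstimate

/-! ### Bounds on the potential -/

lemma abs_le_supN {h : ℝ → ℝ} (hb : ∃ C : ℝ, ∀ x, |h x| ≤ C) (x : ℝ) : |h x| ≤ supN h := by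
  obtain ⟨C, hC⟩ := hb
  exact le_ciSup (f := fun x => |h x|) ⟨C, by rintro _ ⟨x, rfl⟩; exact hC x⟩ x

lemma supN_nonneg (h : ℝ → ℝ) : 0 ≤ supN h := Real.iSup_nonneg fun _ => abs_nonneg _

lemma le_iSup_mem_finset {s : Finset ℕ} {h : ℕ → ℝ} (h0 : ∀ n, 0 ≤ h n) {n : ℕ} (hn : n ∈ s) :
    h n ≤ ⨆ k ∈ s, h k := by
  have hle : ∀ k, ⨆ _ : k ∈ s, h k ≤ ∑ i ∈ s, h i := fun k =>
    Real.iSup_le (fun hk => Finset.single_le_sum (fun i _ => h0 i) hk)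
      (Finset.sum_nonneg fun i _ => h0 i)
  have h1 : ⨆ _ : n ∈ s, h n ≤ ⨆ k ∈ s, h k :=
    le_ciSup (f := fun k => ⨆ _ : k ∈ s, h k) ⟨_, by rintro _ ⟨k, rfl⟩; exact hle k⟩ n
  have : Nonempty (n ∈ s) := ⟨hn⟩
  rwa [ciSup_const] at h1

lemma abs_deriv_le_affine {V : ℝ → ℝ} (hV : Differentiable ℝ (deriv V)) {v₂ : ℝ}
    (h2 : ∀ x, |iteratedDeriv 2 V x| ≤ v₂) (x : ℝ) :
    |deriv V x| ≤ |deriv V 0| + v₂ * |x| := by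
  have h := convex_univ.norm_image_sub_le_of_norm_deriv_le (f := deriv V) (C := v₂)
    (fun y _ => hV y) (fun y _ => by
      have := h2 y
      rwa [iteratedDeriv_succ, iteratedDeriv_one] at this) (Set.mem_univ 0) (Set.mem_univ x)
  rw [sub_zero, Real.norm_eq_abs, Real.norm_eq_abs] at h
  linarith [abs_sub_abs_le_abs_sub (deriv V x) (deriv V 0)]

/-- Propagation of regularity for the semiclassical equation (Proposition 3.1). -/
theorem semiclassical_regularity_propagation (m : ℕ) (hm : 1 ≤ m) (V : ℝ → ℝ)
    (hV : ContDiff ℝ (m+1) V)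
    (hVb : ∀ n : ℕ, 2 ≤ n → n ≤ m+1 → ∃ C : ℝ, ∀ x : ℝ, |iteratedDeriv n V x| ≤ C)
    (S : ℝ → ℝ → ℝ → ℂ) (hS : IsSCSol V S) :
    ∀ t : ℝ, 0 ≤ t → NN m (S t) ≤ NN m (S 0) * Real.exp (CmV m V * t) := by
  intro t ht
  obtain ⟨⟨-, hSch, hC1⟩, heq⟩ := hS
  choose Ψ Ψ' hΨ hΨ' hder _ using hC1
  have hV' : ContDiff ℝ m (deriv V) := (contDiff_succ_iff_deriv.1 hV).2.2
  have hVd : Differentiable ℝ (deriv V) :=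
    hV'.differentiable (by exact_mod_cast (by omega : m ≠ 0))
  set M : ℝ := ⨆ n ∈ Finset.Icc 2 (m+1), supN (iteratedDeriv n V) with hMdef
  have hM0 : 0 ≤ M := Real.iSup_nonneg fun n => Real.iSup_nonneg fun _ => supN_nonneg _
  have hVM : ∀ j < m, ∀ x, |iteratedDeriv (j + 2) V x| ≤ M := fun j hj x =>
    (abs_le_supN (hVb (j + 2) (by omega) (by omega)) x).trans
      (le_iSup_mem_finset (h := fun n => supN (iteratedDeriv n V)) (fun _ => supN_nonneg _)
        (Finset.mem_Icc.2 ⟨by omega, by omega⟩))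
  have hV1 := abs_deriv_le_affine hVd (abs_le_supN (hVb 2 le_rfl (by omega)))
  have hL : ∀ s, 0 ≤ s → ∀ a b α β, MemLp (unc (wD a b α β (S s))) 2 volume :=
    fun s hs a b α β => (memLp_congr_ae (hΨ a b α β s hs)).1 (Lp.memLp _)
  have hgL : ∀ s, 0 ≤ s → ∀ a b α β, MemLp (unc (wD a b α β (dtR S s))) 2 volume :=
    fun s hs a b α β => (memLp_congr_ae (hΨ' a b α β s hs)).1 (Lp.memLp _)
  have hnorm : ∀ s, 0 ≤ s → ∀ q : ℕ × ℕ × ℕ × ℕ,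
      ‖Ψ q.1 q.2.1 q.2.2.1 q.2.2.2 s‖ = L2 (wD q.1 q.2.1 q.2.2.1 q.2.2.2 (S s)) :=
    fun s hs q => by rw [Lp.norm_def, eLpNorm_congr_ae (hΨ _ _ _ _ s hs), L2]
  have hNN : ∀ s, 0 ≤ s → NN m (S s) = ∑ q ∈ weights m, ‖Ψ q.1 q.2.1 q.2.2.1 q.2.2.2 s‖ :=
    fun s hs => Finset.sum_congr rfl fun q _ => (hnorm s hs q).symm
  have hL0 : ∀ h, 0 ≤ L2 h := fun _ => ENNReal.toReal_nonneg
  rw [hNN t ht, hNN 0 le_rfl]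
  refine sum_norm_le_exp_of_inner_deriv_le (weights m)
    (fun q => Ψ q.1 q.2.1 q.2.2.1 q.2.2.2) (fun q => Ψ' q.1 q.2.1 q.2.2.1 q.2.2.2)
    (fun q s => growthBound m |deriv V 0| (supN (iteratedDeriv 2 V)) M
      (fun q => L2 (wD q.1 q.2.1 q.2.2.1 q.2.2.2 (S s))) q) ?_ ?_ ?_ ?_ ?_ ht
  · have := supN_nonneg (iteratedDeriv 2 V)
    rw [CmV, ← hMdef]
    positivity
  · exact fun q s hs => hder _ _ _ _ s hs
  · exact fun q _ s _ =>
      growthBound_nonneg (abs_nonneg _) (supN_nonneg _) hM0 (fun _ => hL0 _) q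
  · rintro ⟨a, b, α, β⟩ hq s hs
    have hb : b ≤ m := by have := mem_weights.1 hq; omega
    rw [hnorm s hs (a, b, α, β), L2.inner_def]
    refine le_trans (le_of_eq (integral_congr_ae ?_))
      (integral_inner_wD_semiclassical_rhs_le hV' (hSch s hs).1 (hL s hs) (heq s hs)
        (abs_nonneg _) (supN_nonneg _) hM0 hV1 hVM hb (hgL s hs a b α β))
    filter_upwards [hΨ a b α β s hs, hΨ' a b α β s hs] with p h1 h2
    rw [h1, h2]
  · intro s hs
    simp only [hnorm s hs]
    refine (sum_growthBound_le (abs_nonneg _) (supN_nonneg _) hM0 fun _ => hL0 _).trans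
      (le_of_eq ?_)
    rw [CmV, ← hMdef]

end
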